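/- Let h : ℝ → ℝ be a continuous function with h(0) = 0. Then the binary operation on ℝ³ defined by (x₁,y₁,z₁) ∗ (x₂,y₂,z₂) = (x₁+x₂, y₁+y₂ + x₂·h(x₁), z₁+z₂ + y₂·h(x₁) + (1/2)x₂·h(x₁)²) is a topological loop multiplication with identity (0,0,0): the operation is continuous, (0,0,0) is a two-sided identity, and for all a, b ∈ ℝ³ each of the equations a ∗ y = b and x ∗ a = b has exactly one solution. -/

import Mathlib

/-- The loop multiplication on `ℝ³` determined by a continuous function `h : ℝ → ℝ`:
`(x₁,y₁,z₁) ∗ (x₂,y₂,z₂) = (x₁+x₂, y₁+y₂ + x₂·h(x₁), z₁+z₂ + y₂·h(x₁) + ½ x₂·h(x₁)²)`. -/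
noncomputable def loopMul (h : ℝ → ℝ) (p q : ℝ × ℝ × ℝ) : ℝ × ℝ × ℝ :=
  (p.1 + q.1, p.2.1 + q.2.1 + q.1 * h p.1,
    p.2.2 + q.2.2 + q.2.1 * h p.1 + (1/2) * q.1 * (h p.1) ^ 2)

/-- For every continuous `h : ℝ → ℝ` with `h(0) = 0` the operation `loopMul h` is a
topological loop multiplication on `ℝ³` with identity `(0,0,0)`: it is continuous,
`(0,0,0)` is a two-sided identity, and the equations `a ∗ y = b` and `x ∗ a = b` have
exactly one solution for all `a, b`. -/
theorem loopMul_is_topological_loop (h : ℝ → ℝ) (hh : Continuous h) (hh0 : h 0 = 0) :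
    Continuous (fun p : (ℝ × ℝ × ℝ) × (ℝ × ℝ × ℝ) => loopMul h p.1 p.2) ∧
    (∀ a : ℝ × ℝ × ℝ, loopMul h (0, 0, 0) a = a ∧ loopMul h a (0, 0, 0) = a) ∧
    (∀ a b : ℝ × ℝ × ℝ,
      (∃! y : ℝ × ℝ × ℝ, loopMul h a y = b) ∧ (∃! x : ℝ × ℝ × ℝ, loopMul h x a = b)) := by
  refine ⟨?_, ?_, ?_⟩
  · unfold loopMul
    fun_prop
  · rintro ⟨a₁, a₂, a₃⟩
    simp [loopMul, hh0]
  · rintro ⟨a₁, a₂, a₃⟩ ⟨b₁, b₂, b₃⟩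
    constructor
    · refine ⟨(b₁ - a₁, b₂ - a₂ - (b₁ - a₁) * h a₁,
        b₃ - a₃ - (b₂ - a₂ - (b₁ - a₁) * h a₁) * h a₁ - (1/2) * (b₁ - a₁) * (h a₁) ^ 2), ?_, ?_⟩
      · simp only [loopMul, Prod.mk.injEq]
        refine ⟨?_, ?_, ?_⟩ <;> ring
      · rintro ⟨y₁, y₂, y₃⟩ hy
        simp only [loopMul, Prod.mk.injEq] at hy ⊢
        obtain ⟨rfl, rfl, rfl⟩ := hy
        refine ⟨?_, ?_, ?_⟩ <;> ring
    · refine ⟨(b₁ - a₁, b₂ - a₂ - a₁ * h (b₁ - a₁),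
        b₃ - a₃ - a₂ * h (b₁ - a₁) - (1/2) * a₁ * (h (b₁ - a₁)) ^ 2), ?_, ?_⟩
      · simp only [loopMul, Prod.mk.injEq]
        refine ⟨?_, ?_, ?_⟩ <;> ring
      · rintro ⟨x₁, x₂, x₃⟩ hx
        simp only [loopMul, Prod.mk.injEq] at hx ⊢
        obtain ⟨rfl, rfl, rfl⟩ := hx
        rw [add_sub_cancel_right]
        refine ⟨?_, ?_, ?_⟩ <;> ring
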